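/- Let T^{(p)}[(S_n, θ_n)_{n∈N}] be a p-convexified mixed Tsirelson space, 1 ≤ p < ∞, with N ⊂ ℕ infinite and θ_n → 0. Then it is isometric to the regular space T^{(p)}[(S_n, θ̄_n)_{n∈ℕ}], where θ̄_n = sup{∏_{i=1}^l θ_{n_i} : Σ_{i=1}^l n_i ≥ n, n₁,…,n_l ∈ N} for each n ∈ ℕ. -/

import Mathlib

open Finset Filter

/-- The minimum of a finite set of naturals (0 for the empty set). -/
noncomputable def fmin (s : Finset ℕ) : ℕ := sInf (s : Set ℕ)

/-- The Schreier families `S_n`, `n ∈ ℕ`. -/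
def SchreierNat : ℕ → Set (Finset ℕ)
  | 0 => {F | F.card ≤ 1}
  | n + 1 => {F | ∃ (k : ℕ) (E : Fin k → Finset ℕ),
      (∀ i, E i ∈ SchreierNat n) ∧
      (∀ i j : Fin k, i < j → ∀ a ∈ E i, ∀ b ∈ E j, a < b) ∧
      (∀ i, ∀ a ∈ E i, k ≤ a) ∧
      F = Finset.univ.biUnion E}

/-- The Schreier family `S_ω`, defined using the sequence `n ↗ ω`. -/
def SchreierOmega : Set (Finset ℕ) :=
  {F | ∃ n : ℕ, F ∈ SchreierNat n ∧ ∀ a ∈ F, n ≤ a}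

/-- A finite sequence `E 0 < E 1 < … < E (k-1)` of nonempty finite subsets of `ℕ` is
`𝒮`-admissible if the set of minima belongs to `𝒮`. -/
def SAdmissible (𝒮 : Set (Finset ℕ)) {k : ℕ} (E : Fin k → Finset ℕ) : Prop :=
  (∀ i, (E i).Nonempty) ∧
  (∀ i j : Fin k, i < j → ∀ a ∈ E i, ∀ b ∈ E j, a < b) ∧
  Finset.image (fun i => fmin (E i)) Finset.univ ∈ 𝒮

/-- Restriction `E x` of a finitely supported vector `x` to a set `E` of coordinates. -/
noncomputable def restr (E : Finset ℕ) (x : ℕ →₀ ℝ) : ℕ →₀ ℝ :=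
  Finsupp.filter (· ∈ E) x

/-- The sup norm `‖x‖_∞` of a finitely supported vector. -/
noncomputable def fsupNorm (x : ℕ →₀ ℝ) : ℝ := ⨆ i, |x i|

/-- `Tn` is (a norm satisfying the implicit equation of) the `p`-convexified mixed
Tsirelson space `T^{(p)}[(S_n, θ_n)_{n ∈ N}]`, as a function on `c₀₀`. -/
def IsMixedTsirelsonNorm (p : ℝ) (N : Set ℕ) (θ : ℕ → ℝ) (Tn : (ℕ →₀ ℝ) → ℝ) : Prop :=
  ∀ x : ℕ →₀ ℝ,
    Tn x = max (fsupNorm x)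
      (sSup {r : ℝ | ∃ n ∈ N, ∃ (k : ℕ) (E : Fin k → Finset ℕ),
        SAdmissible (SchreierNat n) E ∧
        r = θ n ^ (1 / p) * (∑ i, Tn (restr (E i) x) ^ p) ^ (1 / p)})

/-- `Tn` is (a norm satisfying the implicit equation of) the `p`-convexified
Tsirelson-type space `T^{(p)}[S₁, θ] = T^{(p)}_θ`, as a function on `c₀₀`. -/
def IsT1Norm (p θ : ℝ) (Tn : (ℕ →₀ ℝ) → ℝ) : Prop :=
  IsMixedTsirelsonNorm p {1} (fun _ => θ) Tn

/-- Regularity of the sequence of parameters: `(θ_n) ⊂ (0,1)`, `θ_n ↘ 0` and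
`θ_{n+m} ≥ θ_n θ_m`. -/
def RegularParams (θ : ℕ → ℝ) : Prop :=
  (∀ n, 0 < θ n ∧ θ n < 1) ∧ Antitone θ ∧
    Tendsto θ atTop (nhds 0) ∧ ∀ n m, θ n * θ m ≤ θ (n + m)

/-- The regularized parameters `θ̄_n = sup{∏ θ_{n_i} : ∑ n_i ≥ n, n_i ∈ N}`. -/
noncomputable def thetaBar (N : Set ℕ) (θ : ℕ → ℝ) (n : ℕ) : ℝ :=
  sSup {t : ℝ | ∃ l : ℕ, 0 < l ∧ ∃ ns : Fin l → ℕ,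
    (∀ i, ns i ∈ N) ∧ n ≤ ∑ i, ns i ∧ t = ∏ i, θ (ns i)}

/-! ### Schreier families -/

theorem SchreierNat.subset_mem {n : ℕ} {A B : Finset ℕ} (hA : A ∈ SchreierNat n) (hBA : B ⊆ A) :
    B ∈ SchreierNat n := by
  induction n generalizing A B with
  | zero => exact (Finset.card_le_card hBA).trans hA
  | succ n ih =>
    obtain ⟨k, E, hE, hlt, hk, rfl⟩ := hA
    refine ⟨k, fun i => E i ∩ B, fun i => ih (hE i) Finset.inter_subset_left,
      fun i j hij a ha b hb => hlt i j hij a (Finset.mem_inter.1 ha).1 b (Finset.mem_inter.1 hb).1,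
      fun i a ha => hk i a (Finset.mem_inter.1 ha).1, ?_⟩
    rw [← Finset.biUnion_inter, Finset.inter_eq_right.2 hBA]

theorem SchreierNat.image_mem {n : ℕ} {A : Finset ℕ} (hA : A ∈ SchreierNat n) {g : ℕ → ℕ}
    (hg : StrictMonoOn g A) (hle : ∀ a ∈ A, a ≤ g a) : A.image g ∈ SchreierNat n := by
  induction n generalizing A with
  | zero => exact Finset.card_image_le.trans hA
  | succ n ih =>
    obtain ⟨k, E, hE, hlt, hk, rfl⟩ := hA
    have hsub (i : Fin k) : E i ⊆ Finset.univ.biUnion E :=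
      Finset.subset_biUnion_of_mem E (Finset.mem_univ i)
    refine ⟨k, fun i => (E i).image g, fun i => ih (hE i)
      (hg.mono (Finset.coe_subset.2 (hsub i))) fun a ha => hle a (hsub i ha), ?_, ?_, ?_⟩
    · intro i j hij a ha b hb
      obtain ⟨c, hc, rfl⟩ := Finset.mem_image.1 ha
      obtain ⟨d, hd, rfl⟩ := Finset.mem_image.1 hb
      exact hg (hsub i hc) (hsub j hd) (hlt i j hij c hc d hd)
    · intro i a ha
      obtain ⟨c, hc, rfl⟩ := Finset.mem_image.1 ha
      exact (hk i c hc).trans (hle c (hsub i hc))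
    · exact Finset.biUnion_image

theorem SchreierNat.mem_succ_succ {n : ℕ} {A : Finset ℕ} (hA : A ∈ SchreierNat (n + 1)) :
    A ∈ SchreierNat (n + 2) := by
  refine ⟨if A = ∅ then 0 else 1, fun _ => A, fun _ => hA, ?_, ?_, ?_⟩
  · intro i j hij
    have := j.2
    split_ifs at this <;> omega
  · obtain ⟨k, E, -, -, hk, rfl⟩ := hA
    intro i a ha
    obtain ⟨j, -, hj⟩ := Finset.mem_biUnion.1 ha
    have h1 := hk j a hj
    have h2 := j.2
    split_ifs <;> omega
  · ext a
    by_cases h : A = ∅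
    · simp [h]
    · simp [h, show Nonempty (Fin 1) from ⟨0⟩]

theorem SchreierNat.mono {n m : ℕ} (hn : n ≠ 0) (hnm : n ≤ m) {A : Finset ℕ}
    (hA : A ∈ SchreierNat n) : A ∈ SchreierNat m := by
  induction m, hnm using Nat.le_induction with
  | base => exact hA
  | succ m h ih =>
    obtain ⟨m, rfl⟩ := Nat.exists_eq_succ_of_ne_zero (show m ≠ 0 by omega)
    exact SchreierNat.mem_succ_succ ih

theorem SchreierNat.Ico_mem_one (k : ℕ) : Finset.Ico k (k + k) ∈ SchreierNat 1 := by
  refine ⟨k, fun i => {k + i}, fun i => (Finset.card_singleton _).le, ?_, ?_, ?_⟩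
  · simp
  · simp
  · ext a
    simp only [Finset.mem_Ico, Finset.mem_biUnion, Finset.mem_univ, true_and,
      Finset.mem_singleton]
    constructor
    · rintro ⟨h1, h2⟩
      exact ⟨⟨a - k, by omega⟩, by simp; omega⟩
    · rintro ⟨i, rfl⟩
      have := i.2
      omega

/-- The elements of `F` lying between `j ∈ t` and the next element of `t`. -/
def schreierBlock (F t : Finset ℕ) (j : ℕ) : Finset ℕ :=
  F.filter fun a => j ≤ a ∧ ∀ i ∈ t, i ≤ a → i ≤ j

/-- Every set of `S_{n+m}` splits into successive sets of `S_m` whose minima form a set of `S_n`. -/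
theorem SchreierNat.exists_blocks {n m : ℕ} {F : Finset ℕ} (hF : F ∈ SchreierNat (n + m)) :
    ∃ t ⊆ F, t ∈ SchreierNat n ∧ (∀ a ∈ F, ∃ j ∈ t, j ≤ a) ∧
      ∀ j ∈ t, schreierBlock F t j ∈ SchreierNat m := by
  induction n generalizing F with
  | zero =>
    rw [Nat.zero_add] at hF
    rcases F.eq_empty_or_nonempty with rfl | hne
    · exact ⟨∅, subset_rfl, by simp [SchreierNat], by simp, by simp⟩
    · refine ⟨{F.min' hne}, by simpa using F.min'_mem hne, by simp [SchreierNat], ?_, ?_⟩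
      · exact fun a ha => ⟨_, Finset.mem_singleton_self _, F.min'_le a ha⟩
      · exact fun j _ => SchreierNat.subset_mem hF (Finset.filter_subset _ _)
  | succ n ih =>
    rw [Nat.add_right_comm] at hF
    obtain ⟨k, E, hE, hlt, hk, rfl⟩ := hF
    choose t htE htn hta htm using fun i => ih (hE i)
    refine ⟨Finset.univ.biUnion t, Finset.biUnion_mono fun i _ => htE i,
      ⟨k, t, htn, fun i j hij a ha b hb => hlt i j hij a (htE i ha) b (htE j hb),
        fun i a ha => hk i a (htE i ha), rfl⟩, ?_, ?_⟩
    · intro a ha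
      obtain ⟨i, -, hi⟩ := Finset.mem_biUnion.1 ha
      obtain ⟨j, hj, hja⟩ := hta i a hi
      exact ⟨j, Finset.mem_biUnion.2 ⟨i, Finset.mem_univ i, hj⟩, hja⟩
    · intro j hj
      obtain ⟨i, -, hi⟩ := Finset.mem_biUnion.1 hj
      refine SchreierNat.subset_mem (htm i j hi) fun a ha => ?_
      simp only [schreierBlock, Finset.mem_filter, Finset.mem_biUnion, Finset.mem_univ,
        true_and] at ha ⊢
      obtain ⟨⟨i', hi'⟩, hja, hmax⟩ := ha
      have hii' : i' = i := by
        rcases lt_trichotomy i' i with h | h | h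
        · exact absurd (hlt i' i h a hi' j (htE i hi)) (by omega)
        · exact h
        · obtain ⟨j', hj', hj'a⟩ := hta i' a hi'
          have h1 := hmax j' ⟨i', hj'⟩ hj'a
          have h2 := hlt i i' h j (htE i hi) j' (htE i' hj')
          omega
      subst hii'
      exact ⟨hi', hja, fun b hb hba => hmax b ⟨i', hb⟩ hba⟩

/-! ### Successive families indexed by a finite set of naturals -/

/-- The possibly empty sets `E m`, `m ∈ s`, are separated by the points of `s`. -/
def SeparatedBy (s : Finset ℕ) (E : ℕ → Finset ℕ) : Prop :=
  ∀ m ∈ s, ∀ a ∈ E m, m ≤ a ∧ ∀ m' ∈ s, m < m' → a < m'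

theorem fmin_mem {s : Finset ℕ} (hs : s.Nonempty) : fmin s ∈ s :=
  Finset.mem_coe.1 (Nat.sInf_mem (s := (s : Set ℕ)) hs)

theorem fmin_le {s : Finset ℕ} {a : ℕ} (ha : a ∈ s) : fmin s ≤ a :=
  Nat.sInf_le (s := (s : Set ℕ)) ha

theorem SAdmissible.exists_separatedBy {n k : ℕ} {E : Fin k → Finset ℕ}
    (h : SAdmissible (SchreierNat n) E) :
    ∃ s ∈ SchreierNat n, ∃ E' : ℕ → Finset ℕ, SeparatedBy s E' ∧
      ∀ φ : Finset ℕ → ℝ, ∑ i, φ (E i) = ∑ m ∈ s, φ (E' m) := by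
  obtain ⟨hne, hlt, hmem⟩ := h
  have hmono : StrictMono fun i => fmin (E i) := fun i j hij =>
    hlt i j hij _ (fmin_mem (hne i)) _ (fmin_mem (hne j))
  have hext (i : Fin k) :
      Function.extend (fun i => fmin (E i)) E (fun _ => ∅) (fmin (E i)) = E i :=
    hmono.injective.extend_apply E _ i
  refine ⟨_, hmem, Function.extend (fun i => fmin (E i)) E (fun _ => ∅), ?_, ?_⟩
  · intro m hm a ha
    obtain ⟨i, -, rfl⟩ := Finset.mem_image.1 hm
    rw [hext] at ha
    refine ⟨fmin_le ha, fun m' hm' hlt' => ?_⟩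
    obtain ⟨j, -, rfl⟩ := Finset.mem_image.1 hm'
    exact hlt i j (hmono.lt_iff_lt.1 hlt') a ha _ (fmin_mem (hne j))
  · intro φ
    rw [Finset.sum_image hmono.injective.injOn]
    simp only [hext]

theorem SeparatedBy.exists_sAdmissible {n : ℕ} {s : Finset ℕ} {E : ℕ → Finset ℕ}
    (hs : s ∈ SchreierNat n) (hE : SeparatedBy s E) :
    ∃ (k : ℕ) (E' : Fin k → Finset ℕ), SAdmissible (SchreierNat n) E' ∧
      ∀ φ : Finset ℕ → ℝ, φ ∅ = 0 → ∑ m ∈ s, φ (E m) = ∑ i, φ (E' i) := by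
  set u := s.filter fun m => (E m).Nonempty
  have hus : u ⊆ s := Finset.filter_subset _ _
  have hne {m : ℕ} (hm : m ∈ u) : (E m).Nonempty := (Finset.mem_filter.1 hm).2
  have hmemu (i : Fin u.card) : u.orderEmbOfFin rfl i ∈ u := Finset.orderEmbOfFin_mem u rfl i
  have himg : Finset.univ.image (u.orderEmbOfFin rfl) = u := Finset.image_orderEmbOfFin_univ u rfl
  refine ⟨u.card, fun i => E (u.orderEmbOfFin rfl i), ⟨fun i => hne (hmemu i), ?_, ?_⟩, ?_⟩
  · intro i j hij a ha b hb
    exact ((hE _ (hus (hmemu i)) a ha).2 _ (hus (hmemu j))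
      ((u.orderEmbOfFin rfl).strictMono hij)).trans_le (hE _ (hus (hmemu j)) b hb).1
  · have : Finset.univ.image (fun i => fmin (E (u.orderEmbOfFin rfl i)))
        = u.image fun m => fmin (E m) := by
      conv_rhs => rw [← himg, Finset.image_image]
      rfl
    rw [this]
    refine SchreierNat.image_mem (SchreierNat.subset_mem hs hus) (fun a ha b hb hab => ?_) fun a ha => ?_
    · exact ((hE a (hus ha) _ (fmin_mem (hne ha))).2 b (hus hb) hab).trans_le
        (hE b (hus hb) _ (fmin_mem (hne hb))).1
    · exact (hE a (hus ha) _ (fmin_mem (hne ha))).1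
  · intro φ hφ
    have h1 : ∑ m ∈ u, φ (E m) = ∑ m ∈ s, φ (E m) := by
      refine Finset.sum_subset hus fun m hm hmu => ?_
      have : E m = ∅ := by
        by_contra h
        exact hmu (Finset.mem_filter.2 ⟨hm, Finset.nonempty_iff_ne_empty.2 h⟩)
      rw [this, hφ]
    rw [← h1]
    conv_lhs => rw [← himg]
    exact Finset.sum_image (u.orderEmbOfFin rfl).injective.injOn

/-! ### Restrictions and the sup norm -/

theorem restr_apply (E : Finset ℕ) (x : ℕ →₀ ℝ) (i : ℕ) :
    restr E x i = if i ∈ E then x i else 0 := by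
  simp [restr, Finsupp.filter_apply]

theorem restr_restr (E F : Finset ℕ) (x : ℕ →₀ ℝ) : restr E (restr F x) = restr (E ∩ F) x := by
  ext i
  simp only [restr_apply, Finset.mem_inter]
  split_ifs <;> tauto

theorem restr_empty (x : ℕ →₀ ℝ) : restr ∅ x = 0 := by
  ext i
  simp [restr_apply]

theorem support_restr (E : Finset ℕ) (x : ℕ →₀ ℝ) : (restr E x).support = x.support ∩ E := by
  ext i
  simp [restr_apply, and_comm]

theorem restr_inter_support (E : Finset ℕ) (x : ℕ →₀ ℝ) : restr (E ∩ x.support) x = restr E x := by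
  ext i
  simp only [restr_apply, Finset.mem_inter, Finsupp.mem_support_iff]
  split_ifs with h1 h2 h2
  · rfl
  · exact absurd h1.1 h2
  · by_contra h
    exact h1 ⟨h2, fun h' => h h'.symm⟩
  · rfl

theorem restr_eq_self {E : Finset ℕ} {x : ℕ →₀ ℝ} (h : x.support ⊆ E) : restr E x = x := by
  ext i
  rw [restr_apply]
  split_ifs with hi
  · rfl
  · by_contra h'
    exact hi (h (Finsupp.mem_support_iff.2 fun h'' => h' h''.symm))

theorem restr_eq_zero {E : Finset ℕ} {x : ℕ →₀ ℝ} (h : Disjoint x.support E) : restr E x = 0 := by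
  rw [← Finsupp.support_eq_empty, support_restr]
  exact Finset.disjoint_iff_inter_eq_empty.1 h

theorem fsupNorm_nonneg (x : ℕ →₀ ℝ) : 0 ≤ fsupNorm x :=
  Real.iSup_nonneg fun _ => abs_nonneg _

theorem fsupNorm_zero : fsupNorm 0 = 0 := by
  simp [fsupNorm]

theorem bddAbove_range_abs (x : ℕ →₀ ℝ) : BddAbove (Set.range fun i => |x i|) := by
  refine ⟨∑ i ∈ x.support, |x i|, ?_⟩
  rintro _ ⟨i, rfl⟩
  by_cases hi : i ∈ x.support
  · exact Finset.single_le_sum (f := fun i => |x i|) (fun _ _ => abs_nonneg _) hi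
  · simp only [Finsupp.notMem_support_iff.1 hi, abs_zero]
    exact Finset.sum_nonneg fun _ _ => abs_nonneg _

theorem fsupNorm_restr_le (E : Finset ℕ) (x : ℕ →₀ ℝ) : fsupNorm (restr E x) ≤ fsupNorm x := by
  refine ciSup_mono (bddAbove_range_abs x) fun i => ?_
  rw [restr_apply]
  split_ifs
  · exact le_rfl
  · simp

/-! ### Norms satisfying the implicit equation -/

theorem rpow_mul_rpow_le_iff {p a b c : ℝ} (hp : 0 < p) (ha : 0 ≤ a) (hb : 0 ≤ b) (hc : 0 ≤ c) :
    a ^ (1 / p) * b ^ (1 / p) ≤ c ↔ a * b ≤ c ^ p := by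
  rw [← Real.mul_rpow ha hb, one_div, Real.rpow_inv_le_iff_of_pos (mul_nonneg ha hb) hc hp]

namespace IsMixedTsirelsonNorm

variable {p : ℝ} {N : Set ℕ} {θ : ℕ → ℝ} {T : (ℕ →₀ ℝ) → ℝ}

theorem fsupNorm_le (hT : IsMixedTsirelsonNorm p N θ T) (x : ℕ →₀ ℝ) : fsupNorm x ≤ T x := by
  rw [hT x]
  exact le_max_left _ _

theorem nonneg (hT : IsMixedTsirelsonNorm p N θ T) (x : ℕ →₀ ℝ) : 0 ≤ T x :=
  (fsupNorm_nonneg x).trans (hT.fsupNorm_le x)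

theorem sum_nonneg (hT : IsMixedTsirelsonNorm p N θ T) (x : ℕ →₀ ℝ) {ι : Type*} (s : Finset ι)
    (E : ι → Finset ℕ) : 0 ≤ ∑ i ∈ s, T (restr (E i) x) ^ p :=
  Finset.sum_nonneg fun _ _ => Real.rpow_nonneg (hT.nonneg _) _

theorem mul_sum_le_of_bddAbove (hT : IsMixedTsirelsonNorm p N θ T) (hp : 0 < p)
    (hθ : ∀ n ∈ N, 0 ≤ θ n) {x : ℕ →₀ ℝ}
    (hb : BddAbove {r : ℝ | ∃ n ∈ N, ∃ (k : ℕ) (E : Fin k → Finset ℕ),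
        SAdmissible (SchreierNat n) E ∧
        r = θ n ^ (1 / p) * (∑ i, T (restr (E i) x) ^ p) ^ (1 / p)})
    {n : ℕ} (hn : n ∈ N) {k : ℕ} {E : Fin k → Finset ℕ} (hE : SAdmissible (SchreierNat n) E) :
    θ n * ∑ i, T (restr (E i) x) ^ p ≤ T x ^ p := by
  rw [← rpow_mul_rpow_le_iff hp (hθ n hn) (hT.sum_nonneg x _ E) (hT.nonneg x)]
  have h1 := le_csSup hb ⟨n, hn, k, E, hE, rfl⟩
  have h2 := hT x
  exact h1.trans ((le_max_right _ _).trans h2.ge)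

theorem map_zero (hT : IsMixedTsirelsonNorm p N θ T) (hp : 0 < p)
    (hθ : ∀ n ∈ N, 0 < θ n) {n : ℕ} (hn : n ∈ N) (hn0 : n ≠ 0) : T 0 = 0 := by
  by_contra hne
  have hpos : 0 < T 0 := lt_of_le_of_ne (hT.nonneg 0) (Ne.symm hne)
  by_cases hb : BddAbove {r : ℝ | ∃ n ∈ N, ∃ (k : ℕ) (E : Fin k → Finset ℕ),
      SAdmissible (SchreierNat n) E ∧
      r = θ n ^ (1 / p) * (∑ i, T (restr (E i) 0) ^ p) ^ (1 / p)}
  · obtain ⟨k, hk⟩ := exists_nat_gt (1 / θ n)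
    have hs : Finset.Ico k (k + k) ∈ SchreierNat n :=
      SchreierNat.mono one_ne_zero (Nat.one_le_iff_ne_zero.2 hn0) (SchreierNat.Ico_mem_one k)
    have hE : SAdmissible (SchreierNat n) fun i : Fin k => ({k + (i : ℕ)} : Finset ℕ) := by
      refine ⟨fun i => by simp, by simp, SchreierNat.subset_mem hs fun a ha => ?_⟩
      obtain ⟨i, -, rfl⟩ := Finset.mem_image.1 ha
      have h1 := i.2
      have h2 := Finset.mem_singleton.1 (fmin_mem (Finset.singleton_nonempty (k + (i : ℕ))))
      simp only [h2, Finset.mem_Ico]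
      omega
    have h := hT.mul_sum_le_of_bddAbove hp (fun n hn => (hθ n hn).le) hb hn hE
    have h0 (E : Finset ℕ) : restr E 0 = 0 := restr_eq_zero (by simp)
    simp only [h0, Finset.sum_const, Finset.card_univ, Fintype.card_fin, nsmul_eq_mul] at h
    have hTp : 0 < T 0 ^ p := Real.rpow_pos_of_pos hpos p
    rw [div_lt_iff₀ (hθ n hn)] at hk
    nlinarith
  · have h := hT 0
    rw [Real.sSup_of_not_bddAbove hb, fsupNorm_zero, max_self] at h
    exact hne h

theorem bddAbove (hT : IsMixedTsirelsonNorm p N θ T) (hp : 0 < p)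
    (hθ : ∀ n ∈ N, 0 ≤ θ n ∧ θ n ≤ 1) (h0 : T 0 = 0) (x : ℕ →₀ ℝ) :
    BddAbove {r : ℝ | ∃ n ∈ N, ∃ (k : ℕ) (E : Fin k → Finset ℕ),
      SAdmissible (SchreierNat n) E ∧
      r = θ n ^ (1 / p) * (∑ i, T (restr (E i) x) ^ p) ^ (1 / p)} := by
  set M := ∑ F ∈ x.support.powerset, T (restr F x) ^ p
  have hM0 : 0 ≤ M := hT.sum_nonneg x _ id
  have hle (E : Finset ℕ) : T (restr E x) ^ p ≤ M := by
    rw [← restr_inter_support]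
    exact Finset.single_le_sum (f := fun F => T (restr F x) ^ p)
      (fun _ _ => Real.rpow_nonneg (hT.nonneg _) _)
      (Finset.mem_powerset.2 Finset.inter_subset_right)
  refine ⟨((x.support.card : ℝ) * M) ^ (1 / p), ?_⟩
  rintro _ ⟨n, hn, k, E, ⟨-, hlt, -⟩, rfl⟩
  have hsum : ∑ i, T (restr (E i) x) ^ p ≤ x.support.card * M := by
    have h1 (i : Fin k) : T (restr (E i) x) ^ p ≤ ((x.support ∩ E i).card : ℝ) * M := by
      rcases (x.support ∩ E i).eq_empty_or_nonempty with h | h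
      · rw [restr_eq_zero (Finset.disjoint_iff_inter_eq_empty.2 h), h0, Real.zero_rpow hp.ne']
        positivity
      · have : (1 : ℝ) ≤ (x.support ∩ E i).card := by exact_mod_cast h.card_pos
        nlinarith [hle (E i)]
    refine (Finset.sum_le_sum fun i _ => h1 i).trans ?_
    rw [← Finset.sum_mul]
    refine mul_le_mul_of_nonneg_right ?_ hM0
    rw [← Nat.cast_sum, ← Finset.card_biUnion]
    · exact_mod_cast Finset.card_le_card
        (Finset.biUnion_subset.2 fun i _ => Finset.inter_subset_left)
    · intro i _ j _ hij
      refine Finset.disjoint_left.2 fun a hai haj => ?_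
      rw [Finset.mem_inter] at hai haj
      rcases lt_or_gt_of_ne hij with h | h
      · exact lt_irrefl _ (hlt _ _ h a hai.2 a haj.2)
      · exact lt_irrefl _ (hlt _ _ h a haj.2 a hai.2)
  have h2 := Real.rpow_le_one (hθ n hn).1 (hθ n hn).2 (one_div_nonneg.2 hp.le)
  have h3 := Real.rpow_le_rpow (hT.sum_nonneg x _ E) hsum (one_div_nonneg.2 hp.le)
  exact (mul_le_of_le_one_left (Real.rpow_nonneg (hT.sum_nonneg x _ E) _) h2).trans h3

theorem mul_sum_le (hT : IsMixedTsirelsonNorm p N θ T) (hp : 0 < p)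
    (hθ : ∀ n ∈ N, 0 ≤ θ n ∧ θ n ≤ 1) (h0 : T 0 = 0) {n : ℕ} (hn : n ∈ N) {s : Finset ℕ}
    (hs : s ∈ SchreierNat n) {E : ℕ → Finset ℕ} (hE : SeparatedBy s E) (x : ℕ →₀ ℝ) :
    θ n * ∑ m ∈ s, T (restr (E m) x) ^ p ≤ T x ^ p := by
  obtain ⟨k, E', hE', hsum⟩ := hE.exists_sAdmissible hs
  rw [hsum (fun F => T (restr F x) ^ p) (by simp [restr_empty, h0, Real.zero_rpow hp.ne'])]
  exact hT.mul_sum_le_of_bddAbove hp (fun n hn => (hθ n hn).1) (hT.bddAbove hp hθ h0 x) hn hE'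

theorem restr_le (hT : IsMixedTsirelsonNorm p N θ T) (hp : 0 < p)
    (hθ : ∀ n ∈ N, 0 ≤ θ n ∧ θ n ≤ 1) (h0 : T 0 = 0) (F : Finset ℕ) (x : ℕ →₀ ℝ) :
    T (restr F x) ≤ T x := by
  rw [hT (restr F x)]
  refine max_le ((fsupNorm_restr_le F x).trans (hT.fsupNorm_le x)) ?_
  refine Real.sSup_le ?_ (hT.nonneg x)
  rintro _ ⟨n, hn, k, E, hE, rfl⟩
  rw [rpow_mul_rpow_le_iff hp (hθ n hn).1 (hT.sum_nonneg _ _ E) (hT.nonneg x)]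
  obtain ⟨s, hs, E', hE', hsum⟩ := hE.exists_separatedBy
  rw [hsum fun G => T (restr G (restr F x)) ^ p]
  simp only [restr_restr]
  exact hT.mul_sum_le hp hθ h0 hn hs
    (fun m hm a ha => hE' m hm a (Finset.mem_inter.1 ha).1) x

theorem sum_le_of_mem_zero (hT : IsMixedTsirelsonNorm p N θ T) (hp : 0 < p)
    (hθ : ∀ n ∈ N, 0 ≤ θ n ∧ θ n ≤ 1) (h0 : T 0 = 0) {s : Finset ℕ}
    (hs : s ∈ SchreierNat 0) (E : ℕ → Finset ℕ) (x : ℕ →₀ ℝ) :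
    ∑ m ∈ s, T (restr (E m) x) ^ p ≤ T x ^ p := by
  rcases Finset.card_le_one_iff_subset_singleton.1 hs with ⟨a, ha⟩
  refine (Finset.sum_le_sum_of_subset_of_nonneg ha
    fun _ _ _ => Real.rpow_nonneg (hT.nonneg _) _).trans ?_
  rw [Finset.sum_singleton]
  exact Real.rpow_le_rpow (hT.nonneg _) (hT.restr_le hp hθ h0 _ _) hp.le

theorem prod_mul_sum_le (hT : IsMixedTsirelsonNorm p N θ T) (hp : 0 < p)
    (hθ : ∀ n ∈ N, 0 ≤ θ n ∧ θ n ≤ 1) (h0 : T 0 = 0) (ns : List ℕ) (hns : ∀ n ∈ ns, n ∈ N)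
    {s : Finset ℕ} (hs : s ∈ SchreierNat ns.sum) {E : ℕ → Finset ℕ} (hE : SeparatedBy s E)
    (x : ℕ →₀ ℝ) :
    (ns.map θ).prod * ∑ m ∈ s, T (restr (E m) x) ^ p ≤ T x ^ p := by
  induction ns generalizing s E x with
  | nil =>
    simp only [List.map_nil, List.prod_nil, one_mul]
    exact hT.sum_le_of_mem_zero hp hθ h0 hs E x
  | cons n ns ih =>
    have hn : n ∈ N := hns n List.mem_cons_self
    rw [List.sum_cons] at hs
    obtain ⟨t, hts, htn, hta, htm⟩ := SchreierNat.exists_blocks hs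
    set D := schreierBlock s t
    have hDs (j : ℕ) : D j ⊆ s := Finset.filter_subset _ _
    have hDlt {j d j' : ℕ} (hd : d ∈ D j) (hj' : j' ∈ t) (hlt : j < j') : d < j' := by
      by_contra hcon
      have := (Finset.mem_filter.1 hd).2.2 j' hj' (not_lt.1 hcon)
      omega
    have hDle {j d : ℕ} (hd : d ∈ D j) : j ≤ d := (Finset.mem_filter.1 hd).2.1
    have hdisj : (t : Set ℕ).PairwiseDisjoint D := by
      intro i hi j hj hij
      refine Finset.disjoint_left.2 fun a hai haj => ?_
      rcases lt_or_gt_of_ne hij with h | h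
      · exact absurd (hDlt hai hj h) (not_lt.2 (hDle haj))
      · exact absurd (hDlt haj hi h) (not_lt.2 (hDle hai))
    have hcover : t.biUnion D = s := by
      refine Finset.Subset.antisymm (Finset.biUnion_subset.2 fun j _ => hDs j) fun a ha => ?_
      have hne : (t.filter (· ≤ a)).Nonempty := by
        obtain ⟨j, hj, hja⟩ := hta a ha
        exact ⟨j, Finset.mem_filter.2 ⟨hj, hja⟩⟩
      have hmax := Finset.mem_filter.1 ((t.filter (· ≤ a)).max'_mem hne)
      exact Finset.mem_biUnion.2 ⟨_, hmax.1, Finset.mem_filter.2 ⟨ha, hmax.2, fun j' hj' hle =>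
        Finset.le_max' _ _ (Finset.mem_filter.2 ⟨hj', hle⟩)⟩⟩
    have hG : SeparatedBy t fun j => (D j).biUnion E := by
      intro j hj a ha
      obtain ⟨d, hd, had⟩ := Finset.mem_biUnion.1 ha
      obtain ⟨h1, h2⟩ := hE d (hDs j hd) a had
      exact ⟨(hDle hd).trans h1, fun j' hj' hlt => h2 j' (hts hj') (hDlt hd hj' hlt)⟩
    have hblock {j : ℕ} (hj : j ∈ t) :
        (ns.map θ).prod * ∑ d ∈ D j, T (restr (E d) x) ^ p
          ≤ T (restr ((D j).biUnion E) x) ^ p := by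
      have h := ih (fun m hm => hns m (List.mem_cons_of_mem _ hm)) (htm j hj)
        (fun m hm a ha => ⟨(hE m (hDs j hm) a ha).1,
          fun m' hm' => (hE m (hDs j hm) a ha).2 m' (hDs j hm')⟩) (restr ((D j).biUnion E) x)
      refine le_trans (le_of_eq ?_) h
      congr 1
      refine Finset.sum_congr rfl fun d hd => ?_
      rw [restr_restr, Finset.inter_eq_left.2 (Finset.subset_biUnion_of_mem E hd)]
    calc (List.map θ (n :: ns)).prod * ∑ m ∈ s, T (restr (E m) x) ^ p
        = θ n * ∑ j ∈ t, (ns.map θ).prod * ∑ d ∈ D j, T (restr (E d) x) ^ p := by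
          rw [List.map_cons, List.prod_cons, ← hcover, Finset.sum_biUnion hdisj, mul_assoc,
            Finset.mul_sum]
      _ ≤ θ n * ∑ j ∈ t, T (restr ((D j).biUnion E) x) ^ p :=
          mul_le_mul_of_nonneg_left (Finset.sum_le_sum fun j hj => hblock hj) (hθ n hn).1
      _ ≤ T x ^ p := hT.mul_sum_le hp hθ h0 hn htn hG x

/-- A solution of the implicit equation is dominated by any function which dominates the sup norm
and satisfies the lower estimates of the equation. -/
theorem le_of_lower_estimates (hT : IsMixedTsirelsonNorm p N θ T) (hp : 0 < p) {q : ℝ}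
    (hq : q < 1) (hθ : ∀ n ∈ N, 0 ≤ θ n ∧ θ n ≤ q) (h0 : T 0 = 0) {B : (ℕ →₀ ℝ) → ℝ}
    (hB : ∀ x, fsupNorm x ≤ B x)
    (hBE : ∀ n ∈ N, ∀ (k : ℕ) (E : Fin k → Finset ℕ), SAdmissible (SchreierNat n) E →
      ∀ x, θ n * ∑ i, B (restr (E i) x) ^ p ≤ B x ^ p) (x : ℕ →₀ ℝ) : T x ≤ B x := by
  have hB0 (x : ℕ →₀ ℝ) : 0 ≤ B x := (fsupNorm_nonneg x).trans (hB x)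
  induction hc : x.support.card using Nat.strong_induction_on generalizing x with
  | _ c ih =>
  by_contra hcon
  rw [not_le] at hcon
  have hTpos : 0 < T x := (hB0 x).trans_lt hcon
  obtain ⟨n₀, hn₀⟩ : N.Nonempty := by
    by_contra hN
    rw [Set.not_nonempty_iff_eq_empty] at hN
    have h := hT x
    simp only [hN, Set.mem_empty_iff_false, false_and, exists_false, Set.ofPred_false,
      Real.sSup_empty] at h
    rw [max_eq_left (fsupNorm_nonneg x)] at h
    exact absurd (hB x) (by rw [← h]; exact not_le.2 hcon)
  have hq0 : 0 ≤ q := (hθ n₀ hn₀).1.trans (hθ n₀ hn₀).2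
  have hlt : q ^ (1 / p) * T x < T x :=
    mul_lt_of_lt_one_left hTpos (Real.rpow_lt_one hq0 hq (one_div_pos.2 hp))
  refine lt_irrefl (T x) (lt_of_le_of_lt ?_ (max_lt hcon hlt))
  conv_lhs => rw [hT x]
  refine max_le ((hB x).trans (le_max_left _ _)) (Real.sSup_le ?_ ((hB0 x).trans (le_max_left _ _)))
  rintro _ ⟨n, hn, k, E, hE, rfl⟩
  by_cases hfull : ∃ i, x.support ⊆ E i
  · obtain ⟨i, hi⟩ := hfull
    refine le_trans ?_ (le_max_right _ _)
    have hsum : ∑ j, T (restr (E j) x) ^ p = T x ^ p := by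
      rw [Finset.sum_eq_single i, restr_eq_self hi]
      · intro j _ hji
        have : Disjoint x.support (E j) := by
          refine Finset.disjoint_left.2 fun a hax haj => ?_
          rcases lt_or_gt_of_ne hji with h | h
          · exact lt_irrefl _ (hE.2.1 _ _ h a haj a (hi hax))
          · exact lt_irrefl _ (hE.2.1 _ _ h a (hi hax) a haj)
        rw [restr_eq_zero this, h0, Real.zero_rpow hp.ne']
      · simp
    rw [hsum, one_div, Real.rpow_rpow_inv hTpos.le hp.ne']
    exact mul_le_mul_of_nonneg_right
      (Real.rpow_le_rpow (hθ n hn).1 (hθ n hn).2 (inv_nonneg.2 hp.le)) hTpos.le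
  · refine le_trans ?_ (le_max_left _ _)
    rw [rpow_mul_rpow_le_iff hp (hθ n hn).1 (hT.sum_nonneg _ _ E) (hB0 x)]
    refine le_trans (mul_le_mul_of_nonneg_left (Finset.sum_le_sum fun i _ => ?_) (hθ n hn).1)
      (hBE n hn k E hE x)
    refine Real.rpow_le_rpow (hT.nonneg _) (ih _ ?_ _ rfl) hp.le
    rw [← hc, support_restr]
    refine Finset.card_lt_card (Finset.ssubset_iff_subset_ne.2 ⟨Finset.inter_subset_left, ?_⟩)
    exact fun h => hfull ⟨i, Finset.inter_eq_left.1 h⟩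

end IsMixedTsirelsonNorm

/-! ### The regularized parameters -/

theorem Real.sSup_mul_le {S : Set ℝ} {a b : ℝ} (ha : 0 ≤ a) (hb : 0 ≤ b)
    (h : ∀ t ∈ S, t * a ≤ b) : sSup S * a ≤ b := by
  rcases ha.eq_or_lt with rfl | ha
  · simpa using hb
  · rw [← le_div_iff₀ ha]
    exact Real.sSup_le (fun t ht => (le_div_iff₀ ha).2 (h t ht)) (div_nonneg hb ha.le)

theorem exists_uniform_bound_lt_one {N : Set ℕ} {θ : ℕ → ℝ} (hθ : ∀ n ∈ N, θ n < 1)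
    (hθ0 : Tendsto θ (atTop ⊓ Filter.principal N) (nhds 0)) :
    ∃ q : ℝ, 0 < q ∧ q < 1 ∧ ∀ n ∈ N, θ n ≤ q := by
  have hev := hθ0.eventually (gt_mem_nhds (show (0 : ℝ) < 1 / 2 by norm_num))
  rw [eventually_inf_principal, eventually_atTop] at hev
  obtain ⟨M, hM⟩ := hev
  have hfin (M : ℕ) : ∃ q : ℝ, 1 / 2 ≤ q ∧ q < 1 ∧ ∀ n ∈ N, n < M → θ n ≤ q := by
    induction M with
    | zero => exact ⟨1 / 2, le_rfl, by norm_num, fun n _ hn => absurd hn (Nat.not_lt_zero n)⟩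
    | succ M ih =>
      obtain ⟨q, hq, hq1, h⟩ := ih
      by_cases hMN : M ∈ N
      · refine ⟨max q (θ M), hq.trans (le_max_left _ _), max_lt hq1 (hθ M hMN), ?_⟩
        intro n hn hnM
        rcases Nat.lt_succ_iff_lt_or_eq.1 hnM with h' | rfl
        · exact (h n hn h').trans (le_max_left _ _)
        · exact le_max_right _ _
      · refine ⟨q, hq, hq1, fun n hn hnM => h n hn ?_⟩
        rcases Nat.lt_succ_iff_lt_or_eq.1 hnM with h' | rfl
        · exact h'
        · exact absurd hn hMN
  obtain ⟨q, hq, hq1, h⟩ := hfin M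
  refine ⟨q, by linarith, hq1, fun n hn => ?_⟩
  by_cases hnM : n < M
  · exact h n hn hnM
  · exact (hM n (not_lt.1 hnM) hn).le.trans hq

section ThetaBar

variable {N : Set ℕ} {θ : ℕ → ℝ}

theorem prod_le_of_mem (hθ : ∀ n ∈ N, 0 < θ n ∧ θ n < 1) {l : ℕ} {ns : Fin l → ℕ}
    (hns : ∀ i, ns i ∈ N) (i : Fin l) : ∏ j, θ (ns j) ≤ θ (ns i) := by
  rw [← Finset.mul_prod_erase _ _ (Finset.mem_univ i)]
  exact mul_le_of_le_one_right (hθ _ (hns i)).1.le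
    (Finset.prod_le_one (fun j _ => (hθ _ (hns j)).1.le) fun j _ => (hθ _ (hns j)).2.le)

theorem bddAbove_thetaBar (hθ : ∀ n ∈ N, 0 < θ n ∧ θ n < 1) (n : ℕ) :
    BddAbove {t : ℝ | ∃ l : ℕ, 0 < l ∧ ∃ ns : Fin l → ℕ,
      (∀ i, ns i ∈ N) ∧ n ≤ ∑ i, ns i ∧ t = ∏ i, θ (ns i)} := by
  refine ⟨1, ?_⟩
  rintro _ ⟨l, hl, ns, hns, -, rfl⟩
  exact (prod_le_of_mem hθ hns ⟨0, hl⟩).trans (hθ _ (hns _)).2.le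

theorem prod_le_thetaBar (hθ : ∀ n ∈ N, 0 < θ n ∧ θ n < 1) {n l : ℕ} (hl : 0 < l)
    {ns : Fin l → ℕ} (hns : ∀ i, ns i ∈ N) (hsum : n ≤ ∑ i, ns i) :
    ∏ i, θ (ns i) ≤ thetaBar N θ n :=
  le_csSup (bddAbove_thetaBar hθ n) ⟨l, hl, ns, hns, hsum, rfl⟩

theorem le_thetaBar (hθ : ∀ n ∈ N, 0 < θ n ∧ θ n < 1) {n m : ℕ} (hm : m ∈ N) (hnm : n ≤ m) :
    θ m ≤ thetaBar N θ n := by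
  simpa using prod_le_thetaBar hθ one_pos (ns := fun _ => m) (fun _ => hm) (by simpa using hnm)

theorem thetaBar_pos (hN : N.Infinite) (hθ : ∀ n ∈ N, 0 < θ n ∧ θ n < 1) (n : ℕ) :
    0 < thetaBar N θ n := by
  obtain ⟨m, hm, hnm⟩ := hN.exists_gt n
  exact (hθ m hm).1.trans_le (le_thetaBar hθ hm hnm.le)

theorem thetaBar_le (hθ : ∀ n ∈ N, 0 < θ n ∧ θ n < 1) {q : ℝ} (hq0 : 0 ≤ q)
    (hq : ∀ n ∈ N, θ n ≤ q) (n : ℕ) : thetaBar N θ n ≤ q := by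
  refine Real.sSup_le ?_ hq0
  rintro _ ⟨l, hl, ns, hns, -, rfl⟩
  exact (prod_le_of_mem hθ hns ⟨0, hl⟩).trans (hq _ (hns _))

theorem antitone_thetaBar (hN : N.Infinite) (hθ : ∀ n ∈ N, 0 < θ n ∧ θ n < 1) :
    Antitone (thetaBar N θ) := by
  intro n m hnm
  refine Real.sSup_le ?_ (thetaBar_pos hN hθ n).le
  rintro _ ⟨l, hl, ns, hns, hsum, rfl⟩
  exact prod_le_thetaBar hθ hl hns (hnm.trans hsum)

theorem thetaBar_mul_le (hN : N.Infinite) (hθ : ∀ n ∈ N, 0 < θ n ∧ θ n < 1) (n m : ℕ) :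
    thetaBar N θ n * thetaBar N θ m ≤ thetaBar N θ (n + m) := by
  have hpos := fun n => (thetaBar_pos hN hθ n).le
  refine Real.sSup_mul_le (hpos m) (hpos _) ?_
  rintro _ ⟨l, hl, ns, hns, hsum, rfl⟩
  rw [mul_comm]
  refine Real.sSup_mul_le (Finset.prod_nonneg fun i _ => (hθ _ (hns i)).1.le) (hpos _) ?_
  rintro _ ⟨l', hl', ns', hns', hsum', rfl⟩
  have h := prod_le_thetaBar hθ (n := n + m) (Nat.add_pos_left hl' l) (ns := Fin.append ns' ns)
    (fun i => by
      refine Fin.addCases (fun i => ?_) (fun i => ?_) i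
      · rw [Fin.append_left]; exact hns' i
      · rw [Fin.append_right]; exact hns i)
    (by simp only [Fin.sum_univ_add, Fin.append_left, Fin.append_right]; omega)
  simpa only [Fin.prod_univ_add, Fin.append_left, Fin.append_right] using h

theorem tendsto_thetaBar (hN : N.Infinite) (hθ : ∀ n ∈ N, 0 < θ n ∧ θ n < 1)
    (hθ0 : Tendsto θ (atTop ⊓ Filter.principal N) (nhds 0)) :
    Tendsto (thetaBar N θ) atTop (nhds 0) := by
  obtain ⟨q, hq0, hq1, hq⟩ := exists_uniform_bound_lt_one (fun n hn => (hθ n hn).2) hθ0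
  rw [Metric.tendsto_atTop]
  intro ε hε
  obtain ⟨L, hL⟩ := exists_pow_lt_of_lt_one (half_pos hε) hq1
  have hev := hθ0.eventually (gt_mem_nhds (half_pos hε))
  rw [eventually_inf_principal, eventually_atTop] at hev
  obtain ⟨M, hM⟩ := hev
  refine ⟨L * M + 1, fun n hn => ?_⟩
  rw [Real.dist_eq, sub_zero, abs_of_pos (thetaBar_pos hN hθ n)]
  refine lt_of_le_of_lt (Real.sSup_le ?_ (half_pos hε).le) (half_lt_self hε)
  rintro _ ⟨l, hl, ns, hns, hsum, rfl⟩
  by_cases hlL : L ≤ l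
  · calc ∏ i, θ (ns i) ≤ ∏ _i : Fin l, q :=
          Finset.prod_le_prod (fun i _ => (hθ _ (hns i)).1.le) fun i _ => hq _ (hns i)
      _ = q ^ l := by simp
      _ ≤ q ^ L := pow_le_pow_of_le_one hq0.le hq1.le hlL
      _ ≤ ε / 2 := hL.le
  · obtain ⟨i, hi⟩ : ∃ i, M ≤ ns i := by
      by_contra! hcon
      have h1 : ∑ i, ns i ≤ l * M := by
        simpa using Finset.sum_le_card_nsmul Finset.univ ns M fun i _ => (hcon i).le
      have h2 : l * M ≤ L * M := Nat.mul_le_mul_right M (not_le.1 hlL).le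
      omega
    exact (prod_le_of_mem hθ hns i).trans (hM _ hi (hns i)).le

theorem regularParams_thetaBar (hN : N.Infinite) (hθ : ∀ n ∈ N, 0 < θ n ∧ θ n < 1)
    (hθ0 : Tendsto θ (atTop ⊓ Filter.principal N) (nhds 0)) :
    RegularParams (thetaBar N θ) := by
  obtain ⟨q, hq0, hq1, hq⟩ := exists_uniform_bound_lt_one (fun n hn => (hθ n hn).2) hθ0
  exact ⟨fun n => ⟨thetaBar_pos hN hθ n, (thetaBar_le hθ hq0.le hq n).trans_lt hq1⟩,
    antitone_thetaBar hN hθ, tendsto_thetaBar hN hθ hθ0, thetaBar_mul_le hN hθ⟩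

end ThetaBar

theorem IsMixedTsirelsonNorm.thetaBar_mul_sum_le {p : ℝ} {N : Set ℕ} {θ : ℕ → ℝ}
    {T : (ℕ →₀ ℝ) → ℝ} (hT : IsMixedTsirelsonNorm p N θ T) (hp : 0 < p)
    (hθ : ∀ n ∈ N, 0 < θ n ∧ θ n < 1) (h0 : T 0 = 0) {n k : ℕ} {E : Fin k → Finset ℕ}
    (hE : SAdmissible (SchreierNat n) E) (x : ℕ →₀ ℝ) :
    thetaBar N θ n * ∑ i, T (restr (E i) x) ^ p ≤ T x ^ p := by
  have hθ' : ∀ n ∈ N, 0 ≤ θ n ∧ θ n ≤ 1 := fun n hn => ⟨(hθ n hn).1.le, (hθ n hn).2.le⟩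
  refine Real.sSup_mul_le (hT.sum_nonneg x _ E) (Real.rpow_nonneg (hT.nonneg x) p) ?_
  rintro _ ⟨l, hl, ns, hns, hsum, rfl⟩
  obtain ⟨s, hs, E', hE', hs_sum⟩ := hE.exists_separatedBy
  rw [hs_sum fun F => T (restr F x) ^ p]
  by_cases hn : n = 0
  · subst hn
    refine le_trans ?_ (hT.sum_le_of_mem_zero hp hθ' h0 hs E' x)
    exact mul_le_of_le_one_left (hT.sum_nonneg x _ E')
      (Finset.prod_le_one (fun i _ => (hθ _ (hns i)).1.le) fun i _ => (hθ _ (hns i)).2.le)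
  · have h := hT.prod_mul_sum_le hp hθ' h0 (List.ofFn ns)
      (fun m hm => by obtain ⟨i, rfl⟩ := (List.mem_ofFn' _ _).1 hm; exact hns i)
      (SchreierNat.mono hn (by rwa [List.sum_ofFn]) hs) hE' x
    rwa [List.map_ofFn, List.prod_ofFn] at h

/-- A `p`-convexified mixed Tsirelson space `T^{(p)}[(S_n, θ_n)_{n∈N}]`
with `N ⊂ ℕ` infinite and `θ_n → 0` is isometric to the regular space
`T^{(p)}[(S_n, θ̄_n)_{n∈ℕ}]`, where `θ̄_n = sup{∏_{i=1}^l θ_{n_i} : ∑ n_i ≥ n, n_i ∈ N}`: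
the parameters `θ̄` are regular and the two norms agree on `c₀₀`. -/
theorem statement16 (p : ℝ) (hp : 1 ≤ p) (N : Set ℕ) (hN : N.Infinite)
    (θ : ℕ → ℝ) (hθ : ∀ n ∈ N, 0 < θ n ∧ θ n < 1)
    (hθ0 : Tendsto θ (atTop ⊓ Filter.principal N) (nhds 0))
    (Tn : (ℕ →₀ ℝ) → ℝ) (hTn : IsMixedTsirelsonNorm p N θ Tn)
    (Tbar : (ℕ →₀ ℝ) → ℝ) (hTbar : IsMixedTsirelsonNorm p Set.univ (thetaBar N θ) Tbar) :
    RegularParams (thetaBar N θ) ∧ ∀ x : ℕ →₀ ℝ, Tn x = Tbar x := by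
  have hp0 : 0 < p := zero_lt_one.trans_le hp
  have hreg := regularParams_thetaBar hN hθ hθ0
  refine ⟨hreg, fun x => ?_⟩
  obtain ⟨q, hq0, hq1, hq⟩ := exists_uniform_bound_lt_one (fun n hn => (hθ n hn).2) hθ0
  obtain ⟨n₁, hn₁, hn₁0⟩ := hN.exists_gt 0
  have hTn0 : Tn 0 = 0 := hTn.map_zero hp0 (fun n hn => (hθ n hn).1) hn₁ hn₁0.ne'
  have hTbar0 : Tbar 0 = 0 :=
    hTbar.map_zero hp0 (fun n _ => (hreg.1 n).1) (Set.mem_univ 1) one_ne_zero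
  have hbar : ∀ n ∈ Set.univ, 0 ≤ thetaBar N θ n ∧ thetaBar N θ n ≤ 1 :=
    fun n _ => ⟨(hreg.1 n).1.le, (hreg.1 n).2.le⟩
  refine le_antisymm ?_ ?_
  · refine hTn.le_of_lower_estimates hp0 hq1 (fun n hn => ⟨(hθ n hn).1.le, hq n hn⟩) hTn0
      hTbar.fsupNorm_le (fun n hn k E hE x => ?_) x
    refine le_trans (mul_le_mul_of_nonneg_right (le_thetaBar hθ hn le_rfl)
      (hTbar.sum_nonneg x _ E)) ?_
    exact hTbar.mul_sum_le_of_bddAbove hp0 (fun n hn => (hbar n hn).1)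
      (hTbar.bddAbove hp0 hbar hTbar0 x) (Set.mem_univ n) hE
  · exact hTbar.le_of_lower_estimates hp0 hq1
      (fun n _ => ⟨(hreg.1 n).1.le, thetaBar_le hθ hq0.le hq n⟩) hTbar0 hTn.fsupNorm_le
      (fun n _ k E hE x => hTn.thetaBar_mul_sum_le hp0 hθ hTn0 hE x) x
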